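/- Let (G, Γ*) be a self-similar groupoid of type (CF) and K a field. If I_ess ∖ I_tight is nonempty in KS_{(G,Γ*)}, then I_ess ∖ I_tight intersects the K-span KG of G in KS_{(G,Γ*)}. -/

import Mathlib

set_option autoImplicit false

/-! ## Directed graphs and path trees -/

/-- A row-finite directed graph. -/
structure DirGraph where
  V : Type
  E : Type
  src : E → V
  rng : E → V
  rowFinite : ∀ v : V, {e : E | src e = v}.Finite

/-- `Γ.IsPathFrom v l` : the list of edges `l` is a (finite) path with source `v`. -/
def DirGraph.IsPathFrom (Γ : DirGraph) : Γ.V → List Γ.E → Prop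
  | _, [] => True
  | v, e :: l => Γ.src e = v ∧ DirGraph.IsPathFrom Γ (Γ.rng e) l

/-- The range (terminal vertex) of a path with source `v` and edge list `l`. -/
def DirGraph.rng0 (Γ : DirGraph) : Γ.V → List Γ.E → Γ.V
  | v, [] => v
  | _, e :: l => DirGraph.rng0 Γ (Γ.rng e) l

/-- An isomorphism of rooted path trees `(dom)Γ* → (cod)Γ*`: a bijection between the
paths with source `dom` and the paths with source `cod` which fixes the root and maps
children to children (equivalently, a directed-graph isomorphism of the rooted trees). -/
structure Arrow (Γ : DirGraph) where
  dom : Γ.V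
  cod : Γ.V
  act : List Γ.E → List Γ.E
  inv : List Γ.E → List Γ.E
  act_maps : ∀ l, Γ.IsPathFrom dom l → Γ.IsPathFrom cod (act l)
  inv_maps : ∀ l, Γ.IsPathFrom cod l → Γ.IsPathFrom dom (inv l)
  left_inv : ∀ l, Γ.IsPathFrom dom l → inv (act l) = l
  right_inv : ∀ l, Γ.IsPathFrom cod l → act (inv l) = l
  act_nil : act [] = []
  act_snoc : ∀ l e, Γ.IsPathFrom dom (l ++ [e]) → ∃ e', act (l ++ [e]) = act l ++ [e']

/-- The identity tree isomorphism at a vertex `v`. -/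
def Arrow.idArrow (Γ : DirGraph) (v : Γ.V) : Arrow Γ where
  dom := v
  cod := v
  act := fun l => l
  inv := fun l => l
  act_maps := fun _ h => h
  inv_maps := fun _ h => h
  left_inv := fun _ _ => rfl
  right_inv := fun _ _ => rfl
  act_nil := rfl
  act_snoc := fun _ e _ => ⟨e, rfl⟩

namespace Arrow

variable {Γ : DirGraph}

/-- Two arrows represent the same tree isomorphism (they agree on all genuine paths). -/
def Same (g h : Arrow Γ) : Prop :=
  g.dom = h.dom ∧ g.cod = h.cod ∧ ∀ l, Γ.IsPathFrom g.dom l → g.act l = h.act l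

/-- `k` represents the identity isomorphism of `v Γ*`. -/
def IsIdArrow (v : Γ.V) (k : Arrow Γ) : Prop :=
  k.dom = v ∧ k.cod = v ∧ ∀ l, Γ.IsPathFrom v l → k.act l = l

/-- `k` represents the composition `g ∘ h` (first `h`, then `g`). -/
def IsComposition (g h k : Arrow Γ) : Prop :=
  h.cod = g.dom ∧ k.dom = h.dom ∧ k.cod = g.cod ∧
  ∀ l, Γ.IsPathFrom h.dom l → k.act l = g.act (h.act l)

/-- `k` represents the inverse isomorphism of `g`. -/
def IsInverseArrow (g k : Arrow Γ) : Prop :=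
  k.dom = g.cod ∧ k.cod = g.dom ∧ ∀ l, Γ.IsPathFrom g.dom l → k.act (g.act l) = l

/-- `h` represents the restriction `g|_p` of `g` to the path `p`, characterized by
`g(pq) = g(p)·h(q)` for all paths `q` with source `r(p)`. -/
def IsRestrictOf (g : Arrow Γ) (p : List Γ.E) (h : Arrow Γ) : Prop :=
  h.dom = Γ.rng0 g.dom p ∧ h.cod = Γ.rng0 g.cod (g.act p) ∧
  ∀ q, Γ.IsPathFrom (Γ.rng0 g.dom p) q → g.act (p ++ q) = g.act p ++ h.act q

end Arrow

/-! ## Self-similar groupoids -/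

/-- A self-similar groupoid `(G, Γ*)` : a set of tree isomorphisms (closed under
representing-the-same-isomorphism) which contains all the identities, is closed under
composition and inverses (a groupoid with object set `Γ⁰` acting faithfully on `Γ*`),
and is closed under restriction: for every `g ∈ G` and edge `e` in the domain of `g`
there is `g|_e ∈ G` with `g(ep) = g(e)·g|_e(p)`. -/
structure SSG (Γ : DirGraph) where
  carrier : Set (Arrow Γ)
  satur : ∀ g g', g ∈ carrier → g.Same g' → g' ∈ carrier
  id_mem : ∀ v, Arrow.idArrow Γ v ∈ carrier
  comp_mem : ∀ g h k, g ∈ carrier → h ∈ carrier → Arrow.IsComposition g h k → k ∈ carrier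
  inv_mem : ∀ g k, g ∈ carrier → Arrow.IsInverseArrow g k → k ∈ carrier
  restrict_mem : ∀ g ∈ carrier, ∀ e : Γ.E, Γ.src e = g.dom →
    ∃ h ∈ carrier, g.IsRestrictOf [e] h

/-- The condition: for each pair of distinct vertices `v, w` there exist paths
`p ∈ wΓ*` and `q ∈ vΓ*` such that `G` intersects `Iso(r(p), v)` and `Iso(r(q), w)`. -/
def OrbitCond (Γ : DirGraph) (Gs : SSG Γ) : Prop :=
  ∀ v w : Γ.V, v ≠ w →
    (∃ p, Γ.IsPathFrom w p ∧ ∃ g ∈ Gs.carrier, g.dom = Γ.rng0 w p ∧ g.cod = v) ∧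
    (∃ q, Γ.IsPathFrom v q ∧ ∃ g ∈ Gs.carrier, g.dom = Γ.rng0 v q ∧ g.cod = w)

/-- Type (CF): every vertex emits more than one edge, and the orbit condition holds. -/
def TypeCF (Γ : DirGraph) (Gs : SSG Γ) : Prop :=
  (∀ v : Γ.V, ∃ e f : Γ.E, e ≠ f ∧ Γ.src e = v ∧ Γ.src f = v) ∧ OrbitCond Γ Gs

/-! ## Contracting self-similar groupoids, nuclei, recurrent subgroups -/

/-- Every element of `G` eventually restricts into `A`. -/
def ContractsInto {Γ : DirGraph} (Gs : SSG Γ) (A : Set (Arrow Γ)) : Prop :=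
  ∀ g ∈ Gs.carrier, ∃ n : ℕ, ∀ l, Γ.IsPathFrom g.dom l → l.length = n →
    ∃ h ∈ A, g.IsRestrictOf l h

/-- A set of arrows covering only finitely many tree isomorphisms. -/
def FinUpToSame {Γ : DirGraph} (A : Set (Arrow Γ)) : Prop :=
  ∃ B : Finset (Arrow Γ), ∀ g ∈ A, ∃ h ∈ B, g.Same h

/-- `(G, Γ*)` is contracting. -/
def IsContracting {Γ : DirGraph} (Gs : SSG Γ) : Prop :=
  ∃ A : Set (Arrow Γ), A ⊆ Gs.carrier ∧ FinUpToSame A ∧ ContractsInto Gs A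

/-- `N` is the nucleus of `(G, Γ*)` : a minimal finite subset of `G` into which every
element of `G` eventually restricts. -/
def IsNucleus {Γ : DirGraph} (Gs : SSG Γ) (N : Set (Arrow Γ)) : Prop :=
  N ⊆ Gs.carrier ∧ FinUpToSame N ∧ ContractsInto Gs N ∧
  ∀ A : Set (Arrow Γ), A ⊆ Gs.carrier → FinUpToSame A → ContractsInto Gs A →
    ∀ g ∈ N, ∃ h ∈ A, g.Same h

/-- The recurrent set `H_p = {g ∈ G : g(p) = p, g|_p = g}` for a path `p ∈ vΓ*`. -/
def Hp {Γ : DirGraph} (Gs : SSG Γ) (v : Γ.V) (p : List Γ.E) : Set (Arrow Γ) :=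
  {g | g ∈ Gs.carrier ∧ g.dom = v ∧ g.cod = v ∧ g.act p = p ∧ g.IsRestrictOf p g}

/-! ## The associated inverse semigroup `S_{(G,Γ*)}` -/

/-- The product in `S` of a path: `p = e₁ e₂ ⋯ eₙ · r(p)` (just `v` for the empty path). -/
def pathProd {Γ : DirGraph} {S : Type} (mul : S → S → S) (ιV : Γ.V → S) (ιE : Γ.E → S)
    (v : Γ.V) (p : List Γ.E) : S :=
  p.foldr (fun e a => mul (ιE e) a) (ιV (Γ.rng0 v p))

/-- The inverse semigroup with zero `S_{(G,Γ*)}` associated to a self-similar groupoid,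
presented through its characterizing properties: it is an inverse semigroup with zero,
generated by `Γ⁰ ∪ Γ¹ ∪ Γ⁻¹ ∪ G` subject to the defining relations, in which every
nonzero element has a unique canonical form `p g q*`. -/
structure AssocISG (Γ : DirGraph) (Gs : SSG Γ) where
  S : Type
  mul : S → S → S
  zero : S
  star : S → S
  mul_assoc : ∀ a b c, mul (mul a b) c = mul a (mul b c)
  zero_mul : ∀ a, mul zero a = zero
  mul_zero : ∀ a, mul a zero = zero
  inv_ax : ∀ a, mul (mul a (star a)) a = a ∧ mul (mul (star a) a) (star a) = star a
  inv_unique : ∀ a b, mul (mul a b) a = a → mul (mul b a) b = b → b = star a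
  ιV : Γ.V → S
  ιE : Γ.E → S
  ιG : Arrow Γ → S
  ιG_same : ∀ g h, g.Same h → ιG g = ιG h
  rel_src : ∀ e, mul (ιV (Γ.src e)) (ιE e) = ιE e
  rel_rng : ∀ e, mul (ιE e) (ιV (Γ.rng e)) = ιE e
  rel_vv : ∀ u v, u ≠ v → mul (ιV u) (ιV v) = zero
  rel_v_idem : ∀ v, mul (ιV v) (ιV v) = ιV v
  rel_star_v : ∀ v, star (ιV v) = ιV v
  rel_ef : ∀ e f, e ≠ f → mul (star (ιE e)) (ιE f) = zero
  rel_ee : ∀ e, mul (star (ιE e)) (ιE e) = ιV (Γ.rng e)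
  rel_comp : ∀ g h k, g ∈ Gs.carrier → h ∈ Gs.carrier → Arrow.IsComposition g h k →
    mul (ιG g) (ιG h) = ιG k
  rel_notcomp : ∀ g h, g ∈ Gs.carrier → h ∈ Gs.carrier → h.cod ≠ g.dom →
    mul (ιG g) (ιG h) = zero
  rel_star : ∀ g k, g ∈ Gs.carrier → Arrow.IsInverseArrow g k → star (ιG g) = ιG k
  rel_id : ∀ v, ιG (Arrow.idArrow Γ v) = ιV v
  rel_ge : ∀ g ∈ Gs.carrier, ∀ (e e' : Γ.E) (h : Arrow Γ), Γ.src e = g.dom →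
    g.act [e] = [e'] → g.IsRestrictOf [e] h → mul (ιG g) (ιE e) = mul (ιE e') (ιG h)
  canon_ex : ∀ s, s ≠ zero → ∃ (v w : Γ.V) (p q : List Γ.E) (g : Arrow Γ),
    Γ.IsPathFrom v p ∧ Γ.IsPathFrom w q ∧ g ∈ Gs.carrier ∧
    g.dom = Γ.rng0 w q ∧ g.cod = Γ.rng0 v p ∧
    s = mul (mul (pathProd mul ιV ιE v p) (ιG g)) (star (pathProd mul ιV ιE w q))
  canon_nonzero : ∀ (v w : Γ.V) (p q : List Γ.E) (g : Arrow Γ),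
    Γ.IsPathFrom v p → Γ.IsPathFrom w q → g ∈ Gs.carrier →
    g.dom = Γ.rng0 w q → g.cod = Γ.rng0 v p →
    mul (mul (pathProd mul ιV ιE v p) (ιG g)) (star (pathProd mul ιV ιE w q)) ≠ zero
  canon_inj : ∀ (v w v' w' : Γ.V) (p q p' q' : List Γ.E) (g g' : Arrow Γ),
    Γ.IsPathFrom v p → Γ.IsPathFrom w q → g ∈ Gs.carrier →
    g.dom = Γ.rng0 w q → g.cod = Γ.rng0 v p →
    Γ.IsPathFrom v' p' → Γ.IsPathFrom w' q' → g' ∈ Gs.carrier →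
    g'.dom = Γ.rng0 w' q' → g'.cod = Γ.rng0 v' p' →
    mul (mul (pathProd mul ιV ιE v p) (ιG g)) (star (pathProd mul ιV ιE w q)) =
      mul (mul (pathProd mul ιV ιE v' p') (ιG g')) (star (pathProd mul ιV ιE w' q')) →
    v = v' ∧ w = w' ∧ p = p' ∧ q = q' ∧ g.Same g'

namespace AssocISG

variable {Γ : DirGraph} {Gs : SSG Γ}

/-- The element of `S` represented by a path. -/
def P (T : AssocISG Γ Gs) (v : Γ.V) (p : List Γ.E) : T.S :=
  pathProd T.mul T.ιV T.ιE v p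

def IsIdem (T : AssocISG Γ Gs) (e : T.S) : Prop := T.mul e e = e

/-- The natural partial order on idempotents: `f ≤ e` iff `f = g e` for an idempotent `g`. -/
def idemLe (T : AssocISG Γ Gs) (f e : T.S) : Prop := ∃ g, T.IsIdem g ∧ f = T.mul g e

/-- A congruence on `S`. -/
def IsCongruence (T : AssocISG Γ Gs) (r : T.S → T.S → Prop) : Prop :=
  Equivalence r ∧ ∀ a b c, r a b → r (T.mul c a) (T.mul c b) ∧ r (T.mul a c) (T.mul b c)

/-- `S` is congruence-free: its only congruences are equality and the universal relation. -/
def CongruenceFree (T : AssocISG Γ Gs) : Prop :=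
  ∀ r, T.IsCongruence r → (∀ a b, r a b ↔ a = b) ∨ (∀ a b, r a b)

/-- `S` is fundamental. -/
def Fundamental (T : AssocISG Γ Gs) : Prop :=
  ∀ a b : T.S,
    (∀ e, T.IsIdem e → T.mul (T.mul a e) (T.star a) = T.mul (T.mul b e) (T.star b)) → a = b

/-- `S` is 0-simple: its only (two-sided semigroup) ideals are `{0}` and `S`. -/
def ZeroSimple (T : AssocISG Γ Gs) : Prop :=
  ∀ J : Set T.S, J.Nonempty → (∀ s x, x ∈ J → T.mul s x ∈ J ∧ T.mul x s ∈ J) →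
    J = {T.zero} ∨ J = Set.univ

/-- The semilattice of idempotents of `S` is 0-disjunctive. -/
def ZeroDisjunctive (T : AssocISG Γ Gs) : Prop :=
  ∀ e f, T.IsIdem e → T.IsIdem f → e ≠ T.zero → f ≠ T.zero → e ≠ f →
    ∃ h, T.IsIdem h ∧ Xor' (T.mul e h = T.zero) (T.mul f h = T.zero)

end AssocISG

/-! ## The contracted inverse semigroup algebra `K S_{(G,Γ*)}` -/

/-- The contracted inverse semigroup algebra of `S_{(G,Γ*)}` over a field `K` :
a (possibly nonunital) `K`-algebra with basis `S ∖ {0}` and multiplication extending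
that of `S` (identifying the zeros of `S` and `K`). -/
structure ContractedAlg (K : Type) [Field K] {Γ : DirGraph} {Gs : SSG Γ}
    (T : AssocISG Γ Gs) where
  A : Type
  [ringA : NonUnitalRing A]
  [modA : Module K A]
  smul_mul : ∀ (k : K) (a b : A), (k • a) * b = k • (a * b)
  mul_smul_comm : ∀ (k : K) (a b : A), a * (k • b) = k • (a * b)
  δ : T.S → A
  δ_zero : δ T.zero = 0
  δ_mul : ∀ s t, δ (T.mul s t) = δ s * δ t
  indep : LinearIndependent K (fun s : {s : T.S // s ≠ T.zero} => δ s.1)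
  spans : ∀ a : A, a ∈ Submodule.span K (Set.range (fun s : {s : T.S // s ≠ T.zero} => δ s.1))

attribute [instance] ContractedAlg.ringA ContractedAlg.modA

/-- Product of a list in a (nonunital) ring, with the empty product read as `0`. -/
def listProd {A : Type} [Mul A] [Zero A] : List A → A
  | [] => 0
  | a :: l => l.foldl (· * ·) a

namespace ContractedAlg

variable {K : Type} [Field K] {Γ : DirGraph} {Gs : SSG Γ} {T : AssocISG Γ Gs}

/-- A (two-sided, `K`-linear) ideal of the algebra, as a set. -/
def IsIdealSet (C : ContractedAlg K T) (J : Set C.A) : Prop :=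
  (0 : C.A) ∈ J ∧ (∀ x y, x ∈ J → y ∈ J → x + y ∈ J) ∧ (∀ x, x ∈ J → -x ∈ J) ∧
  (∀ (k : K) x, x ∈ J → k • x ∈ J) ∧
  (∀ x y, x ∈ J → y * x ∈ J) ∧ (∀ x y, x ∈ J → x * y ∈ J)

/-- The ideal generated by a set. -/
def idealGen (C : ContractedAlg K T) (X : Set C.A) : Set C.A :=
  ⋂₀ {J | C.IsIdealSet J ∧ X ⊆ J}

/-- The generators `∏_{f ∈ F} (e - f)` of the tight ideal, for `e` a nonzero idempotent
and `F` a finite cover of `e`. -/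
def tightGens (C : ContractedAlg K T) : Set C.A :=
  {x | ∃ (e : T.S) (l : List T.S), T.IsIdem e ∧ e ≠ T.zero ∧ l ≠ [] ∧
    (∀ f ∈ l, T.IsIdem f ∧ T.idemLe f e) ∧
    (∀ g, T.IsIdem g → g ≠ T.zero → T.idemLe g e → ∃ f ∈ l, T.mul g f ≠ T.zero) ∧
    x = listProd (l.map fun f => C.δ e - C.δ f)}

/-- The tight ideal of `K S_{(G,Γ*)}`. -/
def Itight (C : ContractedAlg K T) : Set C.A := C.idealGen C.tightGens

/-- The Cuntz–Krieger generators `v - ∑_{e ∈ vΓ¹} e e*`. -/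
def ckGens (C : ContractedAlg K T) : Set C.A :=
  {x | ∃ v : Γ.V,
    x = C.δ (T.ιV v) -
      ∑ e ∈ (Γ.rowFinite v).toFinset, C.δ (T.mul (T.ιE e) (T.star (T.ιE e)))}

/-- The Cuntz–Krieger ideal of `K S_{(G,Γ*)}`. -/
def Ick (C : ContractedAlg K T) : Set C.A := C.idealGen C.ckGens

/-- An element `a` is singular: for every nonzero idempotent `e` there is a nonzero
idempotent `f ≤ e` with `a f = 0`. -/
def IsSingular (C : ContractedAlg K T) (a : C.A) : Prop :=
  ∀ e, T.IsIdem e → e ≠ T.zero →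
    ∃ f, T.IsIdem f ∧ f ≠ T.zero ∧ T.idemLe f e ∧ a * C.δ f = 0

/-- The essential (singular) ideal of `K S_{(G,Γ*)}`. -/
def Iess (C : ContractedAlg K T) : Set C.A := {a | C.IsSingular a}

/-- The quotient of the algebra by the ideal `I` is simple. -/
def QuotSimple (C : ContractedAlg K T) (I : Set C.A) : Prop :=
  I ≠ Set.univ ∧ ∀ J, C.IsIdealSet J → I ⊆ J → J = I ∨ J = Set.univ

end ContractedAlg
/-! ## Collapsing self-similar groupoids -/

/-- A morphism of directed graphs. -/
structure GraphHom (Γ Λ : DirGraph) where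
  vmap : Γ.V → Λ.V
  emap : Γ.E → Λ.E
  hsrc : ∀ e, Λ.src (emap e) = vmap (Γ.src e)
  hrng : ∀ e, Λ.rng (emap e) = vmap (Γ.rng e)

/-- The induced map on paths. -/
def GraphHom.pmap {Γ Λ : DirGraph} (β : GraphHom Γ Λ) (l : List Γ.E) : List Λ.E :=
  l.map β.emap

/-- `F` is a system of collapsing isomorphisms for `(G, Γ*)` : a wide subgroupoid of `G`
containing all identities, with at most one arrow between any two objects, and with an
arrow `u → v` whenever `G` has one (as produced by choosing orbit representatives `R`
and isomorphisms `f_u` with `id_u = f_u⁻¹ id_v f_u`). -/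
def IsFsystem {Γ : DirGraph} (Gs : SSG Γ) (F : Set (Arrow Γ)) : Prop :=
  F ⊆ Gs.carrier ∧
  (∀ g g', g ∈ F → g.Same g' → g' ∈ F) ∧
  (∀ v, Arrow.idArrow Γ v ∈ F) ∧
  (∀ g h k, g ∈ F → h ∈ F → Arrow.IsComposition g h k → k ∈ F) ∧
  (∀ g k, g ∈ F → Arrow.IsInverseArrow g k → k ∈ F) ∧
  (∀ g g', g ∈ F → g' ∈ F → g.dom = g'.dom → g.cod = g'.cod → g.Same g') ∧
  (∀ g ∈ Gs.carrier, ∃ f ∈ F, f.dom = g.dom ∧ f.cod = g.cod)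

/-- `β : Γ → Λ` is the quotient graph morphism determined by `F` : it is surjective and
locally bijective, its vertex fibres are exactly the `F`-orbits of vertices, and it is
invariant under the action of `F` on paths (so that the fibres on paths are exactly the
`∼_F`-classes). -/
def IsCollapse {Γ Λ : DirGraph} (Gs : SSG Γ) (F : Set (Arrow Γ)) (β : GraphHom Γ Λ) : Prop :=
  Function.Surjective β.vmap ∧
  (∀ v : Γ.V, Set.BijOn β.emap {e | Γ.src e = v} {e' | Λ.src e' = β.vmap v}) ∧
  (∀ u v : Γ.V, β.vmap u = β.vmap v ↔ ∃ f ∈ F, f.dom = u ∧ f.cod = v) ∧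
  (∀ f ∈ F, ∀ l, Γ.IsPathFrom f.dom l → β.pmap (f.act l) = β.pmap l)

/-- `m` is the tree isomorphism of `Λ*` induced by `g` under the identification `β`
(the image `α(g)` of `g` in the collapsed groupoid). -/
def IsPushArrow {Γ Λ : DirGraph} (β : GraphHom Γ Λ) (g : Arrow Γ) (m : Arrow Λ) : Prop :=
  m.dom = β.vmap g.dom ∧ m.cod = β.vmap g.cod ∧
  ∀ l, Γ.IsPathFrom g.dom l → m.act (β.pmap l) = β.pmap (g.act l)

/-- The collapsed groupoid `L = α(G)`, acting on `Λ*`. -/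
def Lcarrier {Γ Λ : DirGraph} (Gs : SSG Γ) (β : GraphHom Γ Λ) : Set (Arrow Λ) :=
  {m | ∃ g ∈ Gs.carrier, IsPushArrow β g m}

/-! ## The graph Δ : cycles of the Moore diagram, the sets `I_q`, synchronization -/

/-- Membership in `N` up to representing the same tree isomorphism. -/
def memSame {Γ : DirGraph} (N : Set (Arrow Γ)) (g : Arrow Γ) : Prop :=
  ∃ h ∈ N, g.Same h

/-- The set `C` of elements of the nucleus `N` lying on a nonempty cycle of the subgraph
`H` of the Moore diagram of `N` consisting of the edges labelled `(e, e)` : `g ∈ C` iff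
`g ∈ N` and there is a nonempty path `p` with `g(p) = p`, `g|_p = g`, and all the
intermediate restrictions `g|_{p'}` (for prefixes `p'` of `p`) in `N`. -/
def Cset {Γ : DirGraph} (N : Set (Arrow Γ)) : Set (Arrow Γ) :=
  {g | memSame N g ∧ ∃ p : List Γ.E, p ≠ [] ∧ Γ.IsPathFrom g.dom p ∧ g.act p = p ∧
    g.IsRestrictOf p g ∧
    ∀ l₁ l₂ : List Γ.E, p = l₁ ++ l₂ → ∃ h, memSame N h ∧ g.IsRestrictOf l₁ h}

/-- The vertex `I_q = q · {id_{r(q)}} = {g ∈ C : g(q) = q, g|_q = id}` of `Δ`,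
for a path `q ∈ vΓ*`. -/
def Iq {Γ : DirGraph} (N : Set (Arrow Γ)) (v : Γ.V) (q : List Γ.E) : Set (Arrow Γ) :=
  {g | g ∈ Cset N ∧ g.dom = v ∧ g.cod = v ∧
    ∀ w, Γ.IsPathFrom (Γ.rng0 v q) w → g.act (q ++ w) = q ++ w}

/-- The path `p ∈ vΓ*` is synchronizing in `Δ` : every path of `Δ` labelled by the
reversal of `p` ends at the same vertex, i.e. `I_{pq} = I_{pq'}` for all `q, q' ∈ r(p)Γ*`. -/
def Synchronizing {Γ : DirGraph} (N : Set (Arrow Γ)) (v : Γ.V) (p : List Γ.E) : Prop :=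
  Γ.IsPathFrom v p ∧
  ∀ q q', Γ.IsPathFrom (Γ.rng0 v p) q → Γ.IsPathFrom (Γ.rng0 v p) q' →
    Iq N v (p ++ q) = Iq N v (p ++ q')

/-- A vertex `X` of `Δ` is synchronized: `X = I_w` for some synchronizing path `w`. -/
def SyncVertex {Γ : DirGraph} (N : Set (Arrow Γ)) (X : Set (Arrow Γ)) : Prop :=
  ∃ v p, Synchronizing N v p ∧ X = Iq N v p

/-- The vertex set `Q = {I_q : q ∈ Γ*}` of the Schreier graph `Δ`. -/
def Qset {Γ : DirGraph} (N : Set (Arrow Γ)) : Set (Set (Arrow Γ)) :=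
  {X | ∃ v q, Γ.IsPathFrom v q ∧ X = Iq N v q}

/-- The edge relation of `Δ` : an edge labelled `e` from `I_q` to `I_{eq}`. -/
def DeltaStep {Γ : DirGraph} (N : Set (Arrow Γ)) (X Y : Set (Arrow Γ)) : Prop :=
  ∃ v q e, Γ.IsPathFrom v q ∧ Γ.rng e = v ∧ X = Iq N v q ∧ Y = Iq N (Γ.src e) (e :: q)

/-- Reachability in `Δ`. -/
def DeltaReaches {Γ : DirGraph} (N : Set (Arrow Γ)) : Set (Arrow Γ) → Set (Arrow Γ) → Prop :=
  Relation.ReflTransGen (DeltaStep N)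

/-- A vertex of `Δ` lying in a minimal strongly connected component with respect to
reachability. -/
def DeltaMinVert {Γ : DirGraph} (N : Set (Arrow Γ)) (X : Set (Arrow Γ)) : Prop :=
  X ∈ Qset N ∧ ∀ Y ∈ Qset N, DeltaReaches N X Y → DeltaReaches N Y X

/- `π_{p,q}(a) = 0` for `a = ∑_{g ∈ Tset} c_g · g ∈ K H_p`, where
`π_{p,q} : K H_p → K[H_p / (H_p ∩ I_q)]` is induced by the canonical map of `H_p` onto
the left cosets of `H_p ∩ I_q` : the sum of the coefficients over each left coset of
`H_p ∩ I_q` vanishes. -/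
open Classical in
def PiZero (K : Type) [Field K] {Γ : DirGraph} (Gs : SSG Γ) (N : Set (Arrow Γ))
    (v : Γ.V) (p q : List Γ.E) (Tset : Finset (Arrow Γ)) (c : Arrow Γ → K) : Prop :=
  ∀ g₀ ∈ Hp Gs v p,
    (∑ h ∈ Tset,
      if ∃ k, k ∈ Hp Gs v p ∧ k ∈ Iq N v q ∧ Arrow.IsComposition g₀ k h then c h else 0) = 0

/-! ## Paths and inverse arrows -/

namespace DirGraph

variable {Γ : DirGraph}

theorem isPathFrom_append {v : Γ.V} {x y : List Γ.E} :
    Γ.IsPathFrom v (x ++ y) ↔ Γ.IsPathFrom v x ∧ Γ.IsPathFrom (Γ.rng0 v x) y := by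
  induction x generalizing v with
  | nil => simp [IsPathFrom, rng0]
  | cons e x ih => simp [IsPathFrom, rng0, ih, and_assoc]

theorem rng0_append (v : Γ.V) (x y : List Γ.E) :
    Γ.rng0 v (x ++ y) = Γ.rng0 (Γ.rng0 v x) y := by
  induction x generalizing v with
  | nil => rfl
  | cons e x ih => exact ih _

end DirGraph

namespace Arrow

variable {Γ : DirGraph}

/-- The inverse tree isomorphism. -/
def symm (g : Arrow Γ) : Arrow Γ where
  dom := g.cod
  cod := g.dom
  act := g.inv
  inv := g.act
  act_maps := g.inv_maps
  inv_maps := g.act_maps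
  left_inv := g.right_inv
  right_inv := g.left_inv
  act_nil := by
    have h := g.left_inv [] trivial
    rwa [g.act_nil] at h
  act_snoc := by
    intro l e hl
    have hm := g.inv_maps _ hl
    have hr := g.right_inv _ hl
    rcases List.eq_nil_or_concat (g.inv (l ++ [e])) with h0 | ⟨m, x, h0⟩
    · rw [h0, g.act_nil] at hr
      simp at hr
    · rw [List.concat_eq_append] at h0
      rw [h0] at hm hr
      obtain ⟨e', he'⟩ := g.act_snoc m x hm
      rw [he'] at hr
      have hml : g.act m = l := (List.append_inj' hr rfl).1
      refine ⟨x, ?_⟩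
      rw [h0, ← hml, g.left_inv m (DirGraph.isPathFrom_append.1 hm).1]

theorem isInverseArrow_symm (g : Arrow Γ) : g.IsInverseArrow g.symm :=
  ⟨rfl, rfl, g.left_inv⟩

end Arrow

/-! ## Computations in the inverse semigroup -/

namespace AssocISG

variable {Γ : DirGraph} {Gs : SSG Γ} (T : AssocISG Γ Gs)

instance : SemigroupWithZero T.S where
  mul := T.mul
  zero := T.zero
  mul_assoc := T.mul_assoc
  zero_mul := T.zero_mul
  mul_zero := T.mul_zero

/-- The adjoint `p* = eₙ* ⋯ e₁*` of a path. -/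
def Q : Γ.V → List Γ.E → T.S
  | v, [] => T.ιV v
  | _, e :: l => Q (Γ.rng e) l * T.star (T.ιE e)

theorem P_nil (v : Γ.V) : T.P v [] = T.ιV v := rfl

theorem P_cons (v : Γ.V) (e : Γ.E) (l : List Γ.E) :
    T.P v (e :: l) = T.ιE e * T.P (Γ.rng e) l := rfl

theorem V_mul_V (v : Γ.V) : T.ιV v * T.ιV v = T.ιV v := T.rel_v_idem v

theorem V_mul_V_of_ne {u v : Γ.V} (h : u ≠ v) : T.ιV u * T.ιV v = 0 := T.rel_vv u v h

theorem V_mul_E (e : Γ.E) : T.ιV (Γ.src e) * T.ιE e = T.ιE e := T.rel_src e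

theorem star_E_mul_E (e : Γ.E) : T.star (T.ιE e) * T.ιE e = T.ιV (Γ.rng e) := T.rel_ee e

theorem mul_star_mul (a : T.S) : a * (T.star a * a) = a := by
  rw [← _root_.mul_assoc]; exact (T.inv_ax a).1

theorem star_mul_star (a : T.S) : T.star a * (a * T.star a) = T.star a := by
  rw [← _root_.mul_assoc]; exact (T.inv_ax a).2

theorem eq_star {a b : T.S} (h₁ : a * (b * a) = a) (h₂ : b * (a * b) = b) : b = T.star a :=
  T.inv_unique a b ((_root_.mul_assoc a b a).trans h₁) ((_root_.mul_assoc b a b).trans h₂)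

theorem star_E_mul_V (e : Γ.E) : T.star (T.ιE e) * T.ιV (Γ.src e) = T.star (T.ιE e) := by
  apply T.eq_star
  · rw [_root_.mul_assoc, V_mul_E, mul_star_mul]
  · rw [_root_.mul_assoc, ← _root_.mul_assoc (T.ιV _) (T.ιE e), V_mul_E,
      ← _root_.mul_assoc (T.ιE e),
      ← _root_.mul_assoc (T.star _), star_mul_star]

variable {v w : Γ.V} {x z : List Γ.E} {g : Arrow Γ}

theorem V_mul_P (hx : Γ.IsPathFrom v x) : T.ιV v * T.P v x = T.P v x := by
  cases x with
  | nil => exact T.V_mul_V v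
  | cons e l => rw [P_cons, ← _root_.mul_assoc, ← hx.1, V_mul_E]

theorem P_append (hx : Γ.IsPathFrom v (x ++ z)) :
    T.P v (x ++ z) = T.P v x * T.P (Γ.rng0 v x) z := by
  induction x generalizing v with
  | nil => exact (T.V_mul_P hx).symm
  | cons e l ih => rw [List.cons_append, P_cons, P_cons, ih hx.2, _root_.mul_assoc]; rfl

theorem P_mul_V (hx : Γ.IsPathFrom v x) : T.P v x * T.ιV (Γ.rng0 v x) = T.P v x := by
  have h := T.P_append (v := v) (x := x) (z := []) (by simpa using hx)
  rw [List.append_nil] at h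
  exact h.symm

theorem Q_mul_V (hx : Γ.IsPathFrom v x) : T.Q v x * T.ιV v = T.Q v x := by
  cases x with
  | nil => exact T.V_mul_V v
  | cons e l => rw [Q, _root_.mul_assoc, ← hx.1, star_E_mul_V]

theorem V_mul_Q (v : Γ.V) (x : List Γ.E) : T.ιV (Γ.rng0 v x) * T.Q v x = T.Q v x := by
  induction x generalizing v with
  | nil => exact T.V_mul_V v
  | cons e l ih => rw [Q, ← _root_.mul_assoc]; exact congrArg (· * _) (ih _)

theorem Q_mul_V_of_ne (hx : Γ.IsPathFrom v x) (h : v ≠ w) : T.Q v x * T.ιV w = 0 := by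
  rw [← T.Q_mul_V hx, _root_.mul_assoc, T.V_mul_V_of_ne h, MulZeroClass.mul_zero]

theorem Q_mul_P (hx : Γ.IsPathFrom v x) : T.Q v x * T.P v x = T.ιV (Γ.rng0 v x) := by
  induction x generalizing v with
  | nil => exact T.V_mul_V v
  | cons e l ih =>
    rw [Q, P_cons, _root_.mul_assoc, ← _root_.mul_assoc (T.star _), star_E_mul_E, T.V_mul_P hx.2,
      ih hx.2]
    rfl

theorem Q_mul_P_append (hx : Γ.IsPathFrom v (x ++ z)) :
    T.Q v x * T.P v (x ++ z) = T.P (Γ.rng0 v x) z := by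
  have h := DirGraph.isPathFrom_append.1 hx
  rw [T.P_append hx, ← _root_.mul_assoc, T.Q_mul_P h.1, T.V_mul_P h.2]

theorem Q_eq_star (hx : Γ.IsPathFrom v x) : T.Q v x = T.star (T.P v x) := by
  apply T.eq_star
  · rw [T.Q_mul_P hx, T.P_mul_V hx]
  · rw [← _root_.mul_assoc, T.Q_mul_P hx, V_mul_Q]

theorem prefix_or_Q_mul_P (hx : Γ.IsPathFrom v x) (hz : Γ.IsPathFrom v z) :
    (∃ y, z = x ++ y) ∨ (∃ y, x = z ++ y) ∨ T.Q v x * T.P v z = 0 := by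
  induction x generalizing v z with
  | nil => exact .inl ⟨z, rfl⟩
  | cons e l ih =>
    cases z with
    | nil => exact .inr (.inl ⟨_, rfl⟩)
    | cons f m =>
      by_cases hef : e = f
      · subst hef
        rw [Q, P_cons, _root_.mul_assoc, ← _root_.mul_assoc (T.star _), star_E_mul_E,
          T.V_mul_P hz.2]
        simpa using ih hx.2 hz.2
      · refine .inr (.inr ?_)
        have h0 : T.star (T.ιE e) * T.ιE f = 0 := T.rel_ef e f hef
        rw [Q, P_cons, _root_.mul_assoc, ← _root_.mul_assoc (T.star _), h0, MulZeroClass.zero_mul,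
          MulZeroClass.mul_zero]

theorem G_mul_V (hg : g ∈ Gs.carrier) : T.ιG g * T.ιV g.dom = T.ιG g := by
  rw [← T.rel_id]
  exact T.rel_comp g _ g hg (Gs.id_mem _) ⟨rfl, rfl, rfl, fun _ _ => rfl⟩

theorem V_mul_G (hg : g ∈ Gs.carrier) : T.ιV g.cod * T.ιG g = T.ιG g := by
  rw [← T.rel_id]
  exact T.rel_comp _ g g (Gs.id_mem _) hg ⟨rfl, rfl, rfl, fun _ _ => rfl⟩

theorem G_mul_star_G (hg : g ∈ Gs.carrier) : T.ιG g * T.star (T.ιG g) = T.ιV g.cod := by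
  rw [T.rel_star g _ hg g.isInverseArrow_symm, ← T.rel_id]
  exact T.rel_comp g _ _ hg (Gs.inv_mem _ _ hg g.isInverseArrow_symm)
    ⟨rfl, rfl, rfl, fun l hl => (g.right_inv l hl).symm⟩

theorem G_mul_P_of_ne (hg : g ∈ Gs.carrier) (hx : Γ.IsPathFrom v x) (h : g.dom ≠ v) :
    T.ιG g * T.P v x = 0 := by
  rw [← T.V_mul_P hx, ← T.G_mul_V hg, _root_.mul_assoc, ← _root_.mul_assoc (T.ιV _),
    T.V_mul_V_of_ne h,
    MulZeroClass.zero_mul, MulZeroClass.mul_zero]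

theorem exists_G_mul_P (hg : g ∈ Gs.carrier) (hx : Γ.IsPathFrom g.dom x) :
    ∃ (y : List Γ.E) (h : Arrow Γ), Γ.IsPathFrom g.cod y ∧ y.length = x.length ∧
      h ∈ Gs.carrier ∧ h.cod = Γ.rng0 g.cod y ∧
      T.ιG g * T.P g.dom x = T.P g.cod y * T.ιG h := by
  induction x generalizing g with
  | nil =>
    exact ⟨[], g, trivial, rfl, hg, rfl, (T.G_mul_V hg).trans (T.V_mul_G hg).symm⟩
  | cons e l ih =>
    have he : Γ.IsPathFrom g.dom ([] ++ [e]) := ⟨hx.1, trivial⟩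
    obtain ⟨e', he'⟩ := g.act_snoc [] e he
    rw [g.act_nil] at he'
    have hp := g.act_maps _ he
    rw [he'] at hp
    simp only [List.nil_append] at he' hp
    obtain ⟨h, hh, hr⟩ := Gs.restrict_mem g hg e hx.1
    have hdom : h.dom = Γ.rng e := hr.1
    have hcod : h.cod = Γ.rng e' := by
      have := hr.2.1
      rwa [he'] at this
    have hmul : T.ιG g * T.ιE e = T.ιE e' * T.ιG h := T.rel_ge g hg e e' h hx.1 he' hr
    obtain ⟨y, k, hy, hlen, hk, hkc, hkm⟩ := ih hh (by rw [hdom]; exact hx.2)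
    rw [hdom, hcod] at hkm
    refine ⟨e' :: y, k, ⟨hp.1, hcod ▸ hy⟩, by simp [hlen], hk, ?_, ?_⟩
    · rw [hkc, hcod]; rfl
    · rw [P_cons, P_cons, ← _root_.mul_assoc, hmul, _root_.mul_assoc, hkm, _root_.mul_assoc]

theorem canon_exists {s : T.S} (hs : s ≠ 0) :
    ∃ (v w : Γ.V) (p q : List Γ.E) (g : Arrow Γ),
      Γ.IsPathFrom v p ∧ Γ.IsPathFrom w q ∧ g ∈ Gs.carrier ∧
      g.dom = Γ.rng0 w q ∧ g.cod = Γ.rng0 v p ∧ s = T.P v p * (T.ιG g * T.Q w q) := by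
  obtain ⟨v, w, p, q, g, hp, hq, hg, hd, hc, h⟩ := T.canon_ex s hs
  refine ⟨v, w, p, q, g, hp, hq, hg, hd, hc, ?_⟩
  rw [T.Q_eq_star hq, ← _root_.mul_assoc]
  exact h

theorem P_mul_Q_ne_zero (hx : Γ.IsPathFrom v x) : T.P v x * T.Q v x ≠ 0 := by
  have h : (T.P v x * T.ιG (Arrow.idArrow Γ (Γ.rng0 v x))) * T.star (T.P v x) ≠ 0 :=
    T.canon_nonzero v v x x _ hx hx (Gs.id_mem _) rfl rfl
  rwa [T.rel_id, T.P_mul_V hx, ← T.Q_eq_star hx] at h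

theorem P_mul_Q_mul_self (hx : Γ.IsPathFrom v x) :
    T.P v x * T.Q v x * (T.P v x * T.Q v x) = T.P v x * T.Q v x := by
  rw [_root_.mul_assoc, ← _root_.mul_assoc (T.Q v x), T.Q_mul_P hx, V_mul_Q]

theorem P_mul_Q_idem (hx : Γ.IsPathFrom v x) : T.IsIdem (T.P v x * T.Q v x) :=
  T.P_mul_Q_mul_self hx

theorem V_ne_zero (v : Γ.V) : T.ιV v ≠ 0 := by
  have h := T.P_mul_Q_ne_zero (v := v) (x := []) trivial
  rwa [P_nil, Q, V_mul_V] at h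

theorem exists_eq_P_mul_Q {e : T.S} (he : T.IsIdem e) (h0 : e ≠ 0) :
    ∃ v x, Γ.IsPathFrom v x ∧ e = T.P v x * T.Q v x := by
  obtain ⟨v, w, p, q, g, hp, hq, hg, hd, hc, h⟩ := T.canon_exists h0
  have hee : e * e = e := he
  have hgV := T.G_mul_V hg
  have hVg := T.V_mul_G hg
  rw [hd] at hgV
  rw [hc] at hVg
  have h₁ : e * (T.P w q * (T.star (T.ιG g) * T.Q v p)) = T.P v p * T.Q v p := by
    calc e * (T.P w q * (T.star (T.ιG g) * T.Q v p))
        = T.P v p * (T.ιG g * (T.Q w q * T.P w q) * T.star (T.ιG g)) * T.Q v p := by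
          rw [h]; simp only [_root_.mul_assoc]
      _ = T.P v p * T.Q v p := by
          rw [T.Q_mul_P hq, hgV, T.G_mul_star_G hg, hc, T.P_mul_V hp]
  have h₂ : T.P w q * (T.star (T.ιG g) * T.Q v p) = T.star e := by
    apply T.eq_star
    · rw [← _root_.mul_assoc, h₁]
      conv_lhs => rw [h]
      rw [_root_.mul_assoc, ← _root_.mul_assoc (T.Q v p), T.Q_mul_P hp,
        ← _root_.mul_assoc (T.ιV _), hVg, ← h]
    · rw [h₁, _root_.mul_assoc, _root_.mul_assoc, ← _root_.mul_assoc (T.Q v p), T.Q_mul_P hp,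
        V_mul_Q]
  have h₃ : e = T.star e := T.eq_star (by rw [hee, hee]) (by rw [hee, hee])
  refine ⟨v, p, hp, ?_⟩
  rw [← h₁, h₂, ← h₃, hee]

theorem P_mul_G_inj {v' : Γ.V} {x' : List Γ.E} {g' : Arrow Γ}
    (hx : Γ.IsPathFrom v x) (hg : g ∈ Gs.carrier) (hc : g.cod = Γ.rng0 v x)
    (hx' : Γ.IsPathFrom v' x') (hg' : g' ∈ Gs.carrier) (hc' : g'.cod = Γ.rng0 v' x')
    (h : T.P v x * T.ιG g = T.P v' x' * T.ιG g') : v = v' ∧ x = x' := by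
  have key : ∀ (u : Γ.V) (y : List Γ.E) (k : Arrow Γ), k ∈ Gs.carrier →
      T.P u y * T.ιG k * T.star (T.P k.dom []) = T.P u y * T.ιG k := fun u y k hk => by
    rw [P_nil, T.rel_star_v, _root_.mul_assoc, T.G_mul_V hk]
  have := T.canon_inj v g.dom v' g'.dom x [] x' [] g g' hx trivial hg rfl hc hx' trivial hg'
    rfl hc' ((key v x g hg).trans (h.trans (key v' x' g' hg').symm))
  exact ⟨this.1, this.2.2.1⟩

end AssocISG

/-! ## Computations in the contracted algebra -/

namespace ContractedAlg

variable {K : Type} [Field K] {Γ : DirGraph} {Gs : SSG Γ} {T : AssocISG Γ Gs}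
  (C : ContractedAlg K T)

instance : IsScalarTower K C.A C.A := ⟨C.smul_mul⟩

instance : SMulCommClass K C.A C.A := ⟨fun k a b => (C.mul_smul_comm k a b).symm⟩

theorem δ_mul' (s t : T.S) : C.δ (s * t) = C.δ s * C.δ t := C.δ_mul s t

theorem δ_zero' : C.δ 0 = 0 := C.δ_zero

theorem δ_induction {p : C.A → Prop} (zero : p 0) (add : ∀ a b, p a → p b → p (a + b))
    (smul : ∀ (k : K) a, p a → p (k • a)) (basis : ∀ s, s ≠ 0 → p (C.δ s)) (a : C.A) : p a := by
  refine Submodule.span_induction (p := fun a _ => p a) ?_ zero (fun a b _ _ => add a b)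
    (fun k a _ => smul k a) (C.spans a)
  rintro _ ⟨s, rfl⟩
  exact basis s.1 s.2

/-- The linear projection onto the span of the basis elements lying in `X`. -/
theorem exists_proj (X : Set T.S) :
    ∃ π : C.A →ₗ[K] C.A, (∀ s ∈ X, π (C.δ s) = C.δ s) ∧ ∀ s ∉ X, π (C.δ s) = 0 := by
  classical
  let b := Module.Basis.mk C.indep (fun a _ => C.spans a)
  have hb : ∀ i, b i = C.δ i.1 := fun i => by simp [b]
  refine ⟨b.constr K fun i => if i.1 ∈ X then C.δ i.1 else 0, fun s hs => ?_, fun s hs => ?_⟩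
  all_goals
    by_cases h0 : s = T.zero
    · rw [h0, C.δ_zero, map_zero]
    · have := b.constr_basis K (fun i => if i.1 ∈ X then C.δ i.1 else 0) ⟨s, h0⟩
      rw [hb] at this
      simpa [hs] using this

theorem isIdealSet_Itight : C.IsIdealSet C.Itight := by
  refine ⟨?_, ?_, ?_, ?_, ?_, ?_⟩
  · exact fun J hJ => hJ.1.1
  · exact fun x y hx hy J hJ => hJ.1.2.1 x y (hx J hJ) (hy J hJ)
  · exact fun x hx J hJ => hJ.1.2.2.1 x (hx J hJ)
  · exact fun k x hx J hJ => hJ.1.2.2.2.1 k x (hx J hJ)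
  · exact fun x y hx J hJ => hJ.1.2.2.2.2.1 x y (hx J hJ)
  · exact fun x y hx J hJ => hJ.1.2.2.2.2.2 x y (hx J hJ)

variable {C}

theorem IsIdealSet.sum_mem {J : Set C.A} (hJ : C.IsIdealSet J) {ι : Type*} (s : Finset ι)
    (f : ι → C.A) (h : ∀ i ∈ s, f i ∈ J) : ∑ i ∈ s, f i ∈ J := by
  classical
  induction s using Finset.induction_on with
  | empty => simpa using hJ.1
  | insert i s hi ih =>
    rw [Finset.sum_insert hi]
    exact hJ.2.1 _ _ (h i (by simp)) (ih fun j hj => h j (by simp [hj]))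

/-- If `a fᵢ ∈ J` for all `fᵢ ≤ e` and `J` contains `∏ (e - fᵢ)`, then `a e ∈ J`. -/
theorem IsIdealSet.mul_mem_of_listProd {J : Set C.A} (hJ : C.IsIdealSet J) {e a : C.A}
    (hee : e * e = e) {l : List C.A} (hl : l ≠ []) (hle : ∀ f ∈ l, e * f = f)
    (ha : ∀ f ∈ l, a * f ∈ J) (hprod : listProd (l.map fun f => e - f) ∈ J) : a * e ∈ J := by
  have sub_mem : ∀ x y, x ∈ J → y ∈ J → x - y ∈ J := fun x y hx hy => by
    rw [sub_eq_add_neg]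
    exact hJ.2.1 _ _ hx (hJ.2.2.1 _ hy)
  have key : ∀ (m : List C.A) (t : C.A), (∀ f ∈ m, e * f = f) → (∀ f ∈ m, a * f ∈ J) →
      a * t - a * e ∈ J → a * (m.map fun f => e - f).foldl (· * ·) t - a * e ∈ J := by
    intro m
    induction m with
    | nil => exact fun t _ _ h => h
    | cons f m ih =>
      intro t h₁ h₂ h
      refine ih _ (fun f' hf' => h₁ f' (by simp [hf'])) (fun f' hf' => h₂ f' (by simp [hf'])) ?_
      have hf : e * f = f := h₁ f (by simp)
      have h₃ : a * (t * (e - f)) - a * e = (a * t - a * e) * (e - f) - a * f := by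
        simp only [sub_mul, mul_sub, mul_assoc, hee, hf]
        abel
      rw [h₃]
      exact sub_mem _ _ (hJ.2.2.2.2.2 _ _ h) (h₂ f (by simp))
  cases l with
  | nil => exact absurd rfl hl
  | cons f l =>
    have h := key l (e - f) (fun f' hf' => hle f' (by simp [hf']))
      (fun f' hf' => ha f' (by simp [hf'])) (by
        rw [mul_sub, sub_sub_cancel_left]
        exact hJ.2.2.1 _ (ha f (by simp)))
    have h' : a * (l.map fun f => e - f).foldl (· * ·) (e - f) ∈ J := hJ.2.2.2.2.1 _ _ hprod
    simpa using sub_mem _ _ h' h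

variable (C)

theorem mul_V_mem_Itight_of_edges {v : Γ.V} (hv : ∃ e, Γ.src e = v) {a : C.A}
    (ha : ∀ e, Γ.src e = v → a * C.δ (T.ιE e) ∈ C.Itight) : a * C.δ (T.ιV v) ∈ C.Itight := by
  obtain ⟨e₀, he₀⟩ := hv
  let L : List T.S := (Γ.rowFinite v).toFinset.toList.map fun e => T.ιE e * T.star (T.ιE e)
  have hL : ∀ f, f ∈ L ↔ ∃ e, Γ.src e = v ∧ T.ιE e * T.star (T.ιE e) = f := by
    intro f
    simp [L]
  have hne : L ≠ [] := List.ne_nil_of_mem ((hL _).2 ⟨e₀, he₀, rfl⟩)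
  have hfv : ∀ e, Γ.src e = v →
      T.ιE e * T.star (T.ιE e) * T.ιV v = T.ιE e * T.star (T.ιE e) := by
    rintro e rfl
    rw [mul_assoc, T.star_E_mul_V]
  have hvf : ∀ e, Γ.src e = v →
      T.ιV v * (T.ιE e * T.star (T.ιE e)) = T.ιE e * T.star (T.ιE e) := by
    rintro e rfl
    rw [← mul_assoc, T.V_mul_E]
  have hidem : ∀ e, T.IsIdem (T.ιE e * T.star (T.ιE e)) := fun e => by
    change (T.ιE e * T.star (T.ιE e)) * (T.ιE e * T.star (T.ιE e)) = _
    rw [mul_assoc, T.star_mul_star]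
  have hgen : listProd (L.map fun f => C.δ (T.ιV v) - C.δ f) ∈ C.Itight := by
    refine fun J hJ => hJ.2 ⟨T.ιV v, L, T.rel_v_idem v, T.V_ne_zero v, hne, ?_, ?_, rfl⟩
    · intro f hf
      obtain ⟨e, he, rfl⟩ := (hL f).1 hf
      exact ⟨hidem e, _, hidem e, (hfv e he).symm⟩
    · intro g hg hg0 ⟨k, _, hk⟩
      have hgv : g * T.ιV v = g := by
        change g = k * T.ιV v at hk
        rw [hk, mul_assoc, T.V_mul_V]
      obtain ⟨u, x, hx, hgx⟩ := T.exists_eq_P_mul_Q hg hg0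
      have huv : u = v := by
        by_contra huv
        rw [hgx, mul_assoc, T.Q_mul_V_of_ne hx huv, mul_zero] at hgv
        rw [← hgx] at hgv
        exact hg0 hgv.symm
      subst huv
      cases x with
      | nil =>
        refine ⟨_, (hL _).2 ⟨e₀, he₀, rfl⟩, fun h0 => ?_⟩
        change g * (T.ιE e₀ * T.star (T.ιE e₀)) = 0 at h0
        rw [hgx, T.P_nil, AssocISG.Q, T.V_mul_V, hvf e₀ he₀] at h0
        apply T.V_ne_zero (Γ.rng e₀)
        rw [← T.star_E_mul_E, ← T.mul_star_mul (T.ιE e₀), ← mul_assoc (T.ιE e₀), h0, zero_mul,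
          mul_zero]
      | cons e l =>
        refine ⟨_, (hL _).2 ⟨e, hx.1, rfl⟩, fun h0 => hg0 ?_⟩
        change g * (T.ιE e * T.star (T.ιE e)) = 0 at h0
        rwa [hgx, AssocISG.Q, mul_assoc, mul_assoc, T.star_mul_star, ← AssocISG.Q, ← hgx] at h0
  refine C.isIdealSet_Itight.mul_mem_of_listProd (l := L.map C.δ) ?_ (by simpa using hne) ?_ ?_ ?_
  · rw [← C.δ_mul', T.V_mul_V]
  · intro f hf
    obtain ⟨s, hs, rfl⟩ := List.mem_map.1 hf
    obtain ⟨e, he, rfl⟩ := (hL s).1 hs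
    rw [← C.δ_mul', hvf e he]
  · intro f hf
    obtain ⟨s, hs, rfl⟩ := List.mem_map.1 hf
    obtain ⟨e, he, rfl⟩ := (hL s).1 hs
    rw [C.δ_mul', ← mul_assoc]
    exact C.isIdealSet_Itight.2.2.2.2.2 _ _ (ha e he)
  · simpa [List.map_map, Function.comp_def] using hgen

theorem mul_V_mem_Itight_of_paths (hΓ : ∀ v : Γ.V, ∃ e, Γ.src e = v) (n : ℕ) (v : Γ.V) (a : C.A)
    (ha : ∀ x, Γ.IsPathFrom v x → x.length = n → a * C.δ (T.P v x) ∈ C.Itight) :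
    a * C.δ (T.ιV v) ∈ C.Itight := by
  induction n generalizing v a with
  | zero => exact ha [] trivial rfl
  | succ n ih =>
    refine C.mul_V_mem_Itight_of_edges (hΓ v) fun e he => ?_
    have h := ih (Γ.rng e) (a * C.δ (T.ιE e)) fun x hx hn => by
      rw [mul_assoc, ← C.δ_mul', ← T.P_cons v]
      exact ha (e :: x) ⟨he, hx⟩ (by simp [hn])
    have hr : T.ιE e * T.ιV (Γ.rng e) = T.ιE e := T.rel_rng e
    rwa [mul_assoc, ← C.δ_mul', hr] at h

theorem exists_sum_mul_V (a : C.A) :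
    ∃ W : Finset Γ.V, ∀ W', W ⊆ W' → ∑ w ∈ W', a * C.δ (T.ιV w) = a := by
  classical
  induction a using C.δ_induction with
  | zero => exact ⟨∅, fun _ _ => by simp⟩
  | add a b ha hb =>
    obtain ⟨W₁, h₁⟩ := ha
    obtain ⟨W₂, h₂⟩ := hb
    refine ⟨W₁ ∪ W₂, fun W' h => ?_⟩
    simp only [add_mul, Finset.sum_add_distrib]
    rw [h₁ W' (Finset.union_subset_left h), h₂ W' (Finset.union_subset_right h)]
  | smul k a ha =>
    obtain ⟨W, hW⟩ := ha
    refine ⟨W, fun W' h => ?_⟩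
    simp only [smul_mul_assoc, ← Finset.smul_sum, hW W' h]
  | basis s hs =>
    obtain ⟨v, w, p, q, g, -, hq, -, -, -, rfl⟩ := T.canon_exists hs
    refine ⟨{w}, fun W' h => ?_⟩
    rw [Finset.sum_eq_single w]
    · rw [← C.δ_mul', mul_assoc, mul_assoc, T.Q_mul_V hq]
    · intro u _ hu
      rw [← C.δ_mul', mul_assoc, mul_assoc, T.Q_mul_V_of_ne hq hu.symm, mul_zero, mul_zero,
        C.δ_zero']
    · exact fun hw => absurd (h (Finset.mem_singleton_self w)) hw

theorem exists_path_notMem_Itight (hΓ : ∀ v : Γ.V, ∃ e, Γ.src e = v) {a : C.A}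
    (ha : a ∉ C.Itight) (n : ℕ) :
    ∃ v x, Γ.IsPathFrom v x ∧ x.length = n ∧ a * C.δ (T.P v x) ∉ C.Itight := by
  by_contra! h
  obtain ⟨W, hW⟩ := C.exists_sum_mul_V a
  apply ha
  rw [← hW W subset_rfl]
  exact C.isIdealSet_Itight.sum_mem _ _ fun w _ =>
    C.mul_V_mem_Itight_of_paths hΓ n w a fun x hx hn => h w x hx hn

theorem isSingular_iff (a : C.A) :
    C.IsSingular a ↔ ∀ v x, Γ.IsPathFrom v x →
      ∃ y, Γ.IsPathFrom v (x ++ y) ∧ a * C.δ (T.P v (x ++ y)) = 0 := by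
  constructor
  · intro h v x hx
    obtain ⟨f, hf, hf0, ⟨k, -, hk⟩, haf⟩ := h _ (T.P_mul_Q_idem hx) (T.P_mul_Q_ne_zero hx)
    obtain ⟨u, z, hz, rfl⟩ := T.exists_eq_P_mul_Q hf hf0
    change _ = k * (T.P v x * T.Q v x) at hk
    have haz : a * C.δ (T.P u z) = 0 := by
      have h₁ : a * C.δ (T.P u z * T.Q u z) * C.δ (T.P u z) = 0 := by rw [haf, zero_mul]
      rwa [mul_assoc, ← C.δ_mul', mul_assoc, T.Q_mul_P hz, T.P_mul_V hz] at h₁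
    have hne : T.Q u z * T.P v x ≠ 0 := fun h0 => hf0 <| by
      change T.P u z * T.Q u z = 0
      have h₁ : T.P u z * T.Q u z * (T.P v x * T.Q v x) = T.P u z * T.Q u z := by
        rw [hk, mul_assoc, T.P_mul_Q_mul_self hx]
      rw [← h₁, mul_assoc, ← mul_assoc (T.Q u z), h0, zero_mul, mul_zero]
    have huv : u = v := by
      by_contra huv
      rw [← T.V_mul_P hx, ← mul_assoc, T.Q_mul_V_of_ne hz huv, zero_mul] at hne
      exact hne rfl
    subst huv
    rcases T.prefix_or_Q_mul_P hz hx with ⟨y, rfl⟩ | ⟨y, rfl⟩ | h0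
    · refine ⟨[], by simpa using hx, ?_⟩
      rw [List.append_nil, T.P_append hx, C.δ_mul', ← mul_assoc, haz, zero_mul]
    · exact ⟨y, hz, haz⟩
    · exact absurd h0 hne
  · intro h e he he0
    obtain ⟨v, x, hx, rfl⟩ := T.exists_eq_P_mul_Q he he0
    obtain ⟨y, hy, hay⟩ := h v x hx
    refine ⟨_, T.P_mul_Q_idem hy, T.P_mul_Q_ne_zero hy, ⟨_, T.P_mul_Q_idem hy, ?_⟩, ?_⟩
    · change _ = T.P v (x ++ y) * T.Q v (x ++ y) * (T.P v x * T.Q v x)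
      have hQ : ∀ (u : Γ.V) (m : List Γ.E), Γ.IsPathFrom u (m ++ y) →
          T.Q u (m ++ y) = T.Q (Γ.rng0 u m) y * T.Q u m := by
        intro u m
        induction m generalizing u with
        | nil => exact fun hm => (T.Q_mul_V hm).symm
        | cons e m ih =>
          intro hm
          rw [List.cons_append, AssocISG.Q, ih _ hm.2, AssocISG.Q, ← mul_assoc]
          rfl
      rw [hQ v x hy]
      have h₂ : T.Q v x * (T.P v x * T.Q v x) = T.Q v x := by
        rw [← mul_assoc, T.Q_mul_P hx, T.V_mul_Q]
      simp only [mul_assoc, h₂]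
    · rw [C.δ_mul', ← mul_assoc, hay, zero_mul]

theorem IsSingular.mul_P {a : C.A} (ha : C.IsSingular a) {v : Γ.V} {x : List Γ.E}
    (hx : Γ.IsPathFrom v x) : C.IsSingular (a * C.δ (T.P v x)) := by
  rw [isSingular_iff] at ha ⊢
  intro u z hz
  by_cases hu : Γ.rng0 v x = u
  · subst hu
    obtain ⟨y, hy, h⟩ := ha v (x ++ z) (DirGraph.isPathFrom_append.2 ⟨hx, hz⟩)
    rw [List.append_assoc] at hy h
    refine ⟨y, (DirGraph.isPathFrom_append.1 hy).2, ?_⟩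
    rwa [mul_assoc, ← C.δ_mul', ← T.P_append hy]
  · refine ⟨[], by simpa using hz, ?_⟩
    rw [List.append_nil, mul_assoc, ← C.δ_mul', ← T.P_mul_V hx, ← T.V_mul_P hz, mul_assoc,
      ← mul_assoc (T.ιV _), T.V_mul_V_of_ne hu, zero_mul, mul_zero, C.δ_zero', mul_zero]

/-- The span of the elements `p g` for a fixed path `p` and `g ∈ G` with codomain `r(p)`. -/
def pathSpan (i : Γ.V × List Γ.E) : Submodule K C.A :=
  Submodule.span K {a | ∃ g ∈ Gs.carrier, Γ.IsPathFrom i.1 i.2 ∧ g.cod = Γ.rng0 i.1 i.2 ∧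
    a = C.δ (T.P i.1 i.2 * T.ιG g)}

theorem exists_mul_P_mem (a : C.A) : ∃ n : ℕ, ∀ v x, Γ.IsPathFrom v x → n ≤ x.length →
    a * C.δ (T.P v x) ∈ ⨆ i, C.pathSpan i := by
  induction a using C.δ_induction with
  | zero => exact ⟨0, fun _ _ _ _ => by simp⟩
  | add a b ha hb =>
    obtain ⟨m, hm⟩ := ha
    obtain ⟨n, hn⟩ := hb
    refine ⟨max m n, fun v x hx h => ?_⟩
    rw [add_mul]
    exact add_mem (hm v x hx (le_of_max_le_left h)) (hn v x hx (le_of_max_le_right h))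
  | smul k a ha =>
    obtain ⟨n, hn⟩ := ha
    refine ⟨n, fun v x hx h => ?_⟩
    rw [smul_mul_assoc]
    exact Submodule.smul_mem _ _ (hn v x hx h)
  | basis s hs =>
    obtain ⟨v, w, p, q, g, hp, hq, hg, hd, hc, rfl⟩ := T.canon_exists hs
    refine ⟨q.length, fun u x hx hlen => ?_⟩
    have hzero : T.Q w q * T.P u x = 0 →
        C.δ (T.P v p * (T.ιG g * T.Q w q)) * C.δ (T.P u x) ∈ ⨆ i, C.pathSpan i := fun h0 => by
      rw [← C.δ_mul', mul_assoc, mul_assoc, h0, mul_zero, mul_zero, C.δ_zero']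
      exact zero_mem _
    by_cases hwu : w = u
    · subst hwu
      have hext : (∃ y, x = q ++ y) ∨ T.Q w q * T.P w x = 0 := by
        rcases T.prefix_or_Q_mul_P hq hx with h | ⟨y, rfl⟩ | h
        · exact .inl h
        · have hy : y = [] := by
            rw [List.length_append] at hlen
            exact List.eq_nil_of_length_eq_zero (by omega)
          exact .inl ⟨[], by simp [hy]⟩
        · exact .inr h
      rcases hext with ⟨y, rfl⟩ | h0
      · have hy : Γ.IsPathFrom g.dom y := hd ▸ (DirGraph.isPathFrom_append.1 hx).2
        obtain ⟨z, k, hz, -, hk, hkc, hmul⟩ := T.exists_G_mul_P hg hy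
        rw [hd, hc] at hmul
        rw [hc] at hz hkc
        have hpz : Γ.IsPathFrom v (p ++ z) := DirGraph.isPathFrom_append.2 ⟨hp, hz⟩
        refine Submodule.mem_iSup_of_mem (v, p ++ z)
          (Submodule.subset_span ⟨k, hk, hpz, ?_, ?_⟩)
        · rw [hkc, DirGraph.rng0_append]
        · rw [← C.δ_mul', mul_assoc, mul_assoc, T.Q_mul_P_append hx, hmul, ← mul_assoc,
            ← T.P_append hpz]
      · exact hzero h0
    · refine hzero ?_
      rw [← T.V_mul_P hx, ← mul_assoc, T.Q_mul_V_of_ne hq hwu, zero_mul]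

/-- The elements `p y g` of the semigroup with `p` fixed and `y` of length `n`. -/
def extensions (T : AssocISG Γ Gs) (i : Γ.V × List Γ.E) (n : ℕ) : Set T.S :=
  {s | ∃ (y : List Γ.E) (g : Arrow Γ), Γ.IsPathFrom i.1 (i.2 ++ y) ∧ y.length = n ∧
    g ∈ Gs.carrier ∧ g.cod = Γ.rng0 i.1 (i.2 ++ y) ∧ s = T.P i.1 (i.2 ++ y) * T.ιG g}

theorem eq_of_mem_extensions {i j : Γ.V × List Γ.E} {n : ℕ} {s : T.S}
    (hi : s ∈ extensions T i n) (hj : s ∈ extensions T j n) : i = j := by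
  obtain ⟨y, g, hy, hyn, hg, hgc, rfl⟩ := hi
  obtain ⟨z, k, hz, hzn, hk, hkc, h⟩ := hj
  obtain ⟨h₁, h₂⟩ := T.P_mul_G_inj hy hg hgc hz hk hkc h
  exact Prod.ext h₁ (List.append_inj' h₂ (hyn.trans hzn.symm)).1

theorem pathSpan_mul_P {i : Γ.V × List Γ.E} {b : C.A} (hb : b ∈ C.pathSpan i) {v : Γ.V}
    {x : List Γ.E} (hx : Γ.IsPathFrom v x) :
    b * C.δ (T.P v x) ∈ Submodule.span K (C.δ '' extensions T i x.length) := by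
  induction hb using Submodule.span_induction with
  | zero => simp
  | add a b _ _ ha hb =>
    rw [add_mul]
    exact add_mem ha hb
  | smul k a _ ha =>
    rw [smul_mul_assoc]
    exact Submodule.smul_mem _ _ ha
  | mem a ha =>
    obtain ⟨g, hg, hi, hc, rfl⟩ := ha
    rw [← C.δ_mul', mul_assoc]
    by_cases hd : g.dom = v
    · subst hd
      obtain ⟨y, k, hy, hlen, hk, hkc, hmul⟩ := T.exists_G_mul_P hg hx
      rw [hc] at hy hkc hmul
      have hiy : Γ.IsPathFrom i.1 (i.2 ++ y) := DirGraph.isPathFrom_append.2 ⟨hi, hy⟩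
      refine Submodule.subset_span ⟨_, ⟨y, k, hiy, hlen, hk, ?_, ?_⟩, rfl⟩
      · rw [hkc, DirGraph.rng0_append]
      · rw [hmul, ← mul_assoc, ← T.P_append hiy]
    · rw [T.G_mul_P_of_ne hg hx hd, mul_zero, C.δ_zero']
      exact zero_mem _

theorem eq_zero_of_sum_eq_zero {n : ℕ} {s : Finset (Γ.V × List Γ.E)}
    {f : Γ.V × List Γ.E → C.A}
    (hf : ∀ i ∈ s, f i ∈ Submodule.span K (C.δ '' extensions T i n))
    (h : ∑ i ∈ s, f i = 0) : ∀ i ∈ s, f i = 0 := by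
  intro i hi
  obtain ⟨π, hπ, hπ'⟩ := C.exists_proj (extensions T i n)
  have h₁ : π (f i) = f i := by
    refine Submodule.span_induction (p := fun a _ => π a = a) ?_ (map_zero π) ?_ ?_ (hf i hi)
    · rintro _ ⟨t, ht, rfl⟩
      exact hπ t ht
    · intro a b _ _ ha hb
      rw [map_add, ha, hb]
    · intro k a _ ha
      rw [map_smul, ha]
  have h₂ : ∀ j ∈ s, j ≠ i → π (f j) = 0 := by
    intro j hj hji
    refine Submodule.span_induction (p := fun a _ => π a = 0) ?_ (map_zero π) ?_ ?_ (hf j hj)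
    · rintro _ ⟨t, ht, rfl⟩
      exact hπ' t fun hti => hji (eq_of_mem_extensions ht hti)
    · intro a b _ _ ha hb
      rw [map_add, ha, hb, add_zero]
    · intro k a _ ha
      rw [map_smul, ha, smul_zero]
  have h₃ := congrArg π h
  rwa [map_sum, Finset.sum_eq_single_of_mem i hi h₂, h₁, map_zero] at h₃

/-- Stripping the fixed path `p` from an element of its span yields an element of `K G`. -/
theorem Q_mul_pathSpan {i : Γ.V × List Γ.E} {b : C.A} (hb : b ∈ C.pathSpan i) :
    C.δ (T.Q i.1 i.2) * b ∈ Submodule.span K (C.δ '' (T.ιG '' Gs.carrier)) ∧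
      C.δ (T.P i.1 i.2) * (C.δ (T.Q i.1 i.2) * b) = b := by
  induction hb using Submodule.span_induction with
  | zero => simp
  | add a b _ _ ha hb =>
    rw [mul_add, mul_add, ha.2, hb.2]
    exact ⟨add_mem ha.1 hb.1, rfl⟩
  | smul k a _ ha =>
    rw [mul_smul_comm, mul_smul_comm, ha.2]
    exact ⟨Submodule.smul_mem _ _ ha.1, rfl⟩
  | mem a ha =>
    obtain ⟨g, hg, hi, hc, rfl⟩ := ha
    have h : T.Q i.1 i.2 * (T.P i.1 i.2 * T.ιG g) = T.ιG g := by
      rw [← mul_assoc, T.Q_mul_P hi, ← hc, T.V_mul_G hg]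
    rw [← C.δ_mul', h, ← C.δ_mul']
    exact ⟨Submodule.subset_span ⟨_, ⟨g, hg, rfl⟩, rfl⟩, rfl⟩

end ContractedAlg

/-! ## STATEMENT 13 -/

/-- Theorem: for a self-similar groupoid of type (CF), if `I_ess ∖ I_tight ≠ ∅` then it
meets the `K`-span `K G` of `G` in `K S_{(G,Γ*)}`. -/
theorem statement13 (K : Type) [Field K] (Γ : DirGraph) (Gs : SSG Γ) (hCF : TypeCF Γ Gs)
    (T : AssocISG Γ Gs) (C : ContractedAlg K T)
    (h : (C.Iess \ C.Itight).Nonempty) :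
    ∃ a ∈ Submodule.span K (C.δ '' (T.ιG '' Gs.carrier)), a ∈ C.Iess \ C.Itight := by
  obtain ⟨a, haE, haT⟩ := h
  have hΓ : ∀ v : Γ.V, ∃ e, Γ.src e = v := fun v => by
    obtain ⟨e, -, -, he, -⟩ := hCF.1 v
    exact ⟨e, he⟩
  obtain ⟨n, hn⟩ := C.exists_mul_P_mem a
  obtain ⟨v, x, hx, hlen, hxT⟩ := C.exists_path_notMem_Itight hΓ haT n
  have hxE := (C.isSingular_iff _).1 (ContractedAlg.IsSingular.mul_P C haE hx)
  obtain ⟨f, hf, hsum⟩ := (Submodule.mem_iSup_iff_exists_finsupp _ _).1 (hn v x hx hlen.ge)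
  rw [Finsupp.sum] at hsum
  have hi : ∃ i ∈ f.support, f i ∉ C.Itight := by
    by_contra! hall
    exact hxT (hsum ▸ C.isIdealSet_Itight.sum_mem _ _ hall)
  obtain ⟨i, hi, hiT⟩ := hi
  obtain ⟨hG, hback⟩ := C.Q_mul_pathSpan (hf i)
  refine ⟨_, hG, (C.isSingular_iff _).2 fun w z hz => ?_, fun hT => hiT ?_⟩
  · obtain ⟨y, hy, h0⟩ := hxE w z hz
    refine ⟨y, hy, ?_⟩
    rw [← hsum, Finset.sum_mul] at h0
    rw [mul_assoc, C.eq_zero_of_sum_eq_zero (fun j _ => C.pathSpan_mul_P (hf j) hy) h0 i hi,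
      mul_zero]
  · rw [← hback]
    exact C.isIdealSet_Itight.2.2.2.2.1 _ _ hT
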